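/- Fix a real parameter α ≥ 2. Every solution of Hill's lunar equations whose initial phase point satisfies E(Γ(0)) = E* and W(Γ(0)) > 0 exists globally in forward time (T_max = ∞). -/

import Mathlib

open Real Set Filter Topology ENNReal

/-- r = √(x² + y²), the distance to the origin in the configuration plane. -/
noncomputable def hillR (x y : ℝ) : ℝ := Real.sqrt (x ^ 2 + y ^ 2)

/-- The effective potential V(x,y) = −((α+2)/2)x² − (α+2)/r^α. -/
noncomputable def hillV (α x y : ℝ) : ℝ :=
  -((α + 2) / 2) * x ^ 2 - (α + 2) / (hillR x y) ^ α

/-- The partial derivative V_x. -/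
noncomputable def hillVx (α x y : ℝ) : ℝ :=
  -(α + 2) * x + (α + 2) * α * x / (hillR x y) ^ (α + 2)

/-- The partial derivative V_y. -/
noncomputable def hillVy (α x y : ℝ) : ℝ :=
  (α + 2) * α * y / (hillR x y) ^ (α + 2)

/-- The energy E(Γ) = ½(ẋ² + ẏ²) + V(x,y). -/
noncomputable def hillE (α x y vx vy : ℝ) : ℝ :=
  (1 / 2) * (vx ^ 2 + vy ^ 2) + hillV α x y

/-- W(Γ) = −xV_x − yV_y = (α+2)(x² − α/r^α). -/
noncomputable def hillW (α x y : ℝ) : ℝ :=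
  (α + 2) * (x ^ 2 - α / (hillR x y) ^ α)

/-- K(Γ) = ẋ² + ẏ² + 2(xẏ − ẋy) + W(Γ). -/
noncomputable def hillK (α x y vx vy : ℝ) : ℝ :=
  vx ^ 2 + vy ^ 2 + 2 * (x * vy - vx * y) + hillW α x y

/-- The ground state energy E* = −½(α+2)²α^{−α/(α+2)}. -/
noncomputable def hillEstar (α : ℝ) : ℝ :=
  -(1 / 2) * (α + 2) ^ 2 * α ^ (-(α / (α + 2)))

/-- The time interval [0, Tmax), where Tmax ∈ (0, ∞]. -/
def hillDomain (Tmax : ℝ≥0∞) : Set ℝ := {t : ℝ | 0 ≤ t ∧ ENNReal.ofReal t < Tmax}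

/-- `HillSolOn α x y Tmax` : (x(t), y(t)) is a solution of Hill's lunar equations
ẍ − 2ẏ = −V_x, ÿ + 2ẋ = −V_y avoiding the origin on the interval [0, Tmax). -/
def HillSolOn (α : ℝ) (x y : ℝ → ℝ) (Tmax : ℝ≥0∞) : Prop :=
  ∀ t ∈ hillDomain Tmax,
    (x t, y t) ≠ (0, 0) ∧
    HasDerivAt x (deriv x t) t ∧ HasDerivAt y (deriv y t) t ∧
    HasDerivAt (deriv x) (2 * deriv y t - hillVx α (x t) (y t)) t ∧
    HasDerivAt (deriv y) (-(2 * deriv x t) - hillVy α (x t) (y t)) t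

/-- `HillMaxSol α x y Tmax` : (x(t), y(t)) is a solution of Hill's lunar equations on its
maximal interval of existence [0, Tmax): no solution on a strictly larger interval extends it. -/
def HillMaxSol (α : ℝ) (x y : ℝ → ℝ) (Tmax : ℝ≥0∞) : Prop :=
  HillSolOn α x y Tmax ∧
  ∀ T' : ℝ≥0∞, Tmax < T' →
    ¬∃ x₂ y₂ : ℝ → ℝ, HillSolOn α x₂ y₂ T' ∧
      ∀ t ∈ hillDomain Tmax, x₂ t = x t ∧ y₂ t = y t

lemma hillR_pos {x y : ℝ} (h : (x, y) ≠ (0, 0)) : 0 < hillR x y := by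
  unfold hillR
  apply Real.sqrt_pos.2
  by_contra hc
  apply h
  have hx : x = 0 := by nlinarith [sq_nonneg x, sq_nonneg y]
  have hy : y = 0 := by nlinarith [sq_nonneg x, sq_nonneg y]
  rw [hx, hy]

lemma hillR_sq (x y : ℝ) : hillR x y ^ 2 = x ^ 2 + y ^ 2 := by
  unfold hillR
  exact Real.sq_sqrt (by positivity)

lemma hillR_rpow_add {x y : ℝ} (α : ℝ) (h : 0 < hillR x y) :
    hillR x y ^ (α + 2) = hillR x y ^ α * (x ^ 2 + y ^ 2) := by
  rw [Real.rpow_add h, ← hillR_sq]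
  norm_num

/-- The phase-space vector field. -/
noncomputable def hillF (α : ℝ) (p : ℝ × ℝ × ℝ × ℝ) : ℝ × ℝ × ℝ × ℝ :=
  (p.2.2.1, p.2.2.2, 2 * p.2.2.2 - hillVx α p.1 p.2.1, -(2 * p.2.2.1) - hillVy α p.1 p.2.1)

lemma hillF_contDiffAt (α : ℝ) (p : ℝ × ℝ × ℝ × ℝ) (h : (p.1, p.2.1) ≠ (0, 0)) :
    ContDiffAt ℝ 1 (hillF α) p := by
  have hp := hillR_pos h
  have hs : p.1 ^ 2 + p.2.1 ^ 2 ≠ 0 := by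
    rw [← hillR_sq]; positivity
  have hR : ContDiffAt ℝ 1 (fun q : ℝ × ℝ × ℝ × ℝ => hillR q.1 q.2.1) p := by
    unfold hillR
    exact ContDiffAt.sqrt (by fun_prop) hs
  have hRp : ContDiffAt ℝ 1 (fun q : ℝ × ℝ × ℝ × ℝ => hillR q.1 q.2.1 ^ (α + 2)) p :=
    hR.rpow_const_of_ne hp.ne'
  have hne : hillR p.1 p.2.1 ^ (α + 2) ≠ 0 := (Real.rpow_pos_of_pos hp _).ne'
  unfold hillF hillVx hillVy
  refine ContDiffAt.prodMk (by fun_prop) (ContDiffAt.prodMk (by fun_prop)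
    (ContDiffAt.prodMk ?_ ?_))
  · refine ContDiffAt.sub (by fun_prop) (ContDiffAt.add (by fun_prop) ?_)
    exact ContDiffAt.div (by fun_prop) hRp hne
  · refine ContDiffAt.sub (by fun_prop) ?_
    exact ContDiffAt.div (by fun_prop) hRp hne

lemma hillR_hasDerivAt {x y : ℝ → ℝ} {u v t : ℝ} (hx : HasDerivAt x u t) (hy : HasDerivAt y v t)
    (h : (x t, y t) ≠ (0, 0)) :
    HasDerivAt (fun s => hillR (x s) (y s)) ((x t * u + y t * v) / hillR (x t) (y t)) t := by
  have hp := hillR_pos h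
  have hs : x t ^ 2 + y t ^ 2 ≠ 0 := by
    rw [← hillR_sq]; positivity
  have := (((hx.pow 2).add (hy.pow 2))).sqrt hs
  have h2 : HasDerivAt (fun s => hillR (x s) (y s)) _ t := this
  refine h2.congr_deriv ?_
  change _ / (2 * hillR (x t) (y t)) = _
  push_cast
  field_simp

lemma hillRpow_hasDerivAt {α : ℝ} {x y : ℝ → ℝ} {u v t : ℝ} (hx : HasDerivAt x u t)
    (hy : HasDerivAt y v t) (h : (x t, y t) ≠ (0, 0)) :
    HasDerivAt (fun s => hillR (x s) (y s) ^ α)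
      (α * hillR (x t) (y t) ^ α * (x t * u + y t * v) / hillR (x t) (y t) ^ 2) t := by
  have hp := hillR_pos h
  have := (hillR_hasDerivAt hx hy h).rpow_const (p := α) (Or.inl hp.ne')
  convert this using 1
  rw [Real.rpow_sub_one hp.ne']
  field_simp

lemma hillV_hasDerivAt {α : ℝ} {x y : ℝ → ℝ} {u v t : ℝ} (hx : HasDerivAt x u t)
    (hy : HasDerivAt y v t) (h : (x t, y t) ≠ (0, 0)) :
    HasDerivAt (fun s => hillV α (x s) (y s))
      (hillVx α (x t) (y t) * u + hillVy α (x t) (y t) * v) t := by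
  have hp := hillR_pos h
  have hq : 0 < hillR (x t) (y t) ^ α := Real.rpow_pos_of_pos hp _
  have h1 := hillRpow_hasDerivAt (α := α) hx hy h
  have h2 := ((hx.pow 2).const_mul (-((α + 2) / 2))).sub
    ((hasDerivAt_const t (α + 2)).div h1 hq.ne')
  have h3 : HasDerivAt (fun s => hillV α (x s) (y s)) _ t := h2
  refine h3.congr_deriv ?_
  unfold hillVx hillVy
  push_cast
  rw [hillR_rpow_add α hp, ← hillR_sq]
  field_simp
  ring

lemma hillE_hasDerivAt {α : ℝ} {x y u v : ℝ → ℝ} {t : ℝ} (hx : HasDerivAt x (u t) t)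
    (hy : HasDerivAt y (v t) t) (h : (x t, y t) ≠ (0, 0))
    (hu : HasDerivAt u (2 * v t - hillVx α (x t) (y t)) t)
    (hv : HasDerivAt v (-(2 * u t) - hillVy α (x t) (y t)) t) :
    HasDerivAt (fun s => hillE α (x s) (y s) (u s) (v s)) 0 t := by
  have h2 := (((hu.pow 2).add (hv.pow 2)).const_mul (1 / 2)).add
    (hillV_hasDerivAt (α := α) hx hy h)
  have h3 : HasDerivAt (fun s => hillE α (x s) (y s) (u s) (v s)) _ t := h2
  refine h3.congr_deriv ?_
  push_cast
  ring

lemma hillW_continuousAt {α : ℝ} {x y : ℝ → ℝ} {t : ℝ} (hx : ContinuousAt x t)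
    (hy : ContinuousAt y t) (h : (x t, y t) ≠ (0, 0)) :
    ContinuousAt (fun s => hillW α (x s) (y s)) t := by
  have hp := hillR_pos h
  have hq : 0 < hillR (x t) (y t) ^ α := Real.rpow_pos_of_pos hp _
  have hR : ContinuousAt (fun s => hillR (x s) (y s)) t := by
    unfold hillR
    exact ((hx.pow 2).add (hy.pow 2)).sqrt
  have hR2 : ContinuousAt (fun s => hillR (x s) (y s) ^ α) t := hR.rpow_const (Or.inl hp.ne')
  unfold hillW
  exact continuousAt_const.mul ((hx.pow 2).sub (continuousAt_const.div hR2 hq.ne'))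

lemma hillW_nonneg_r {α x y : ℝ} (hα : 2 ≤ α) (h : (x, y) ≠ (0, 0)) (hW : 0 ≤ hillW α x y) :
    α ≤ hillR x y ^ (α + 2) := by
  have hp := hillR_pos h
  have hq : 0 < hillR x y ^ α := Real.rpow_pos_of_pos hp _
  have h1 : 0 ≤ x ^ 2 - α / hillR x y ^ α := by
    unfold hillW at hW
    exact nonneg_of_mul_nonneg_right hW (by linarith)
  have h2 : α ≤ x ^ 2 * hillR x y ^ α := by
    rw [← div_le_iff₀ hq]; linarith
  rw [hillR_rpow_add α hp]
  nlinarith [mul_nonneg hq.le (sq_nonneg y)]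

lemma hillR_ge_one {α x y : ℝ} (hα : 2 ≤ α) (h : (x, y) ≠ (0, 0)) (hW : 0 ≤ hillW α x y) :
    1 ≤ hillR x y := by
  have hp := hillR_pos h
  have h1 := hillW_nonneg_r hα h hW
  by_contra hc
  have := Real.rpow_lt_one hp.le (not_le.1 hc) (show 0 < α + 2 by linarith)
  linarith

lemma hill_equilibrium {α x y u v : ℝ} (hα : 2 ≤ α) (h : (x, y) ≠ (0, 0))
    (hW : hillW α x y = 0) (hE : hillE α x y u v = hillEstar α) :
    u = 0 ∧ v = 0 ∧ y = 0 ∧ hillR x y ^ (α + 2) = α := by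
  have hp := hillR_pos h
  have hq : 0 < hillR x y ^ α := Real.rpow_pos_of_pos hp _
  have h1 := hillW_nonneg_r hα h hW.ge
  have h2 : x ^ 2 = α / hillR x y ^ α := by
    unfold hillW at hW
    rcases mul_eq_zero.1 hW with h' | h' <;> linarith
  have hα2 : 0 < α + 2 := by linarith
  have hα0 : 0 < α := by linarith
  have h3 : α ^ (α / (α + 2)) ≤ hillR x y ^ α := by
    have := Real.rpow_le_rpow hα0.le h1 (show 0 ≤ α / (α + 2) by positivity)
    rwa [← Real.rpow_mul hp.le, mul_div_cancel₀ _ hα2.ne'] at this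
  have hc : 0 < α ^ (α / (α + 2)) := Real.rpow_pos_of_pos hα0 _
  have h4 : (hillR x y ^ α)⁻¹ ≤ (α ^ (α / (α + 2)))⁻¹ := inv_anti₀ hc h3
  have h5 : (1 / 2) * (u ^ 2 + v ^ 2)
      = (α + 2) ^ 2 / 2 * ((hillR x y ^ α)⁻¹ - (α ^ (α / (α + 2)))⁻¹) := by
    unfold hillE hillV hillEstar at hE
    rw [Real.rpow_neg hα0.le] at hE
    rw [h2] at hE
    simp only [div_eq_mul_inv] at hE ⊢
    linear_combination hE
  have h6 : (α + 2) ^ 2 / 2 * ((hillR x y ^ α)⁻¹ - (α ^ (α / (α + 2)))⁻¹) ≤ 0 :=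
    mul_nonpos_of_nonneg_of_nonpos (by positivity) (by linarith)
  have hu : u = 0 := by nlinarith [sq_nonneg u, sq_nonneg v]
  have hv : v = 0 := by nlinarith [sq_nonneg u, sq_nonneg v]
  have h7 : (hillR x y ^ α)⁻¹ = (α ^ (α / (α + 2)))⁻¹ := by
    rw [hu, hv] at h5
    have : (α + 2) ^ 2 / 2 * ((hillR x y ^ α)⁻¹ - (α ^ (α / (α + 2)))⁻¹) = 0 := by
      rw [← h5]; ring
    rcases mul_eq_zero.1 this with h' | h'
    · have : 0 < (α + 2) ^ 2 / 2 := by positivity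
      linarith
    · linarith
  have h8 : hillR x y ^ (α + 2) = α := by
    have h9 := inv_injective h7
    have : (hillR x y ^ α) ^ ((α + 2) / α) = (α ^ (α / (α + 2))) ^ ((α + 2) / α) := by rw [h9]
    rw [← Real.rpow_mul hp.le, ← Real.rpow_mul hα0.le, mul_div_cancel₀ _ hα0.ne'] at this
    rw [this, show α / (α + 2) * ((α + 2) / α) = 1 by field_simp, Real.rpow_one]
  refine ⟨hu, hv, ?_, h8⟩
  rw [hillR_rpow_add α hp, h2] at h8
  have : hillR x y ^ α * y ^ 2 = 0 := by
    rw [mul_add, mul_div_cancel₀ _ hq.ne'] at h8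
    linarith
  rcases mul_eq_zero.1 this with h' | h'
  · exact absurd h' hq.ne'
  · exact pow_eq_zero_iff (two_ne_zero) |>.1 h'

lemma hill_speed {α x y u v : ℝ} (hα : 2 ≤ α) (h : (x, y) ≠ (0, 0))
    (hW : 0 ≤ hillW α x y) (hE : hillE α x y u v = hillEstar α) :
    u ^ 2 + v ^ 2 ≤ (α + 2) * (x ^ 2 + 2) := by
  have h1 := hillR_ge_one hα h hW
  have h2 : 1 ≤ hillR x y ^ α := Real.one_le_rpow h1 (by linarith)
  have h3 : (α + 2) / hillR x y ^ α ≤ α + 2 := div_le_self (by linarith) h2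
  have h4 : 0 < α ^ (-(α / (α + 2))) := Real.rpow_pos_of_pos (by linarith) _
  have h5 : 0 < (α + 2) ^ 2 * α ^ (-(α / (α + 2))) := by positivity
  unfold hillE hillV hillEstar at hE
  linarith

lemma hill_force {α x y : ℝ} (hα : 2 ≤ α) (h : (x, y) ≠ (0, 0)) (hW : 0 ≤ hillW α x y) :
    |hillVx α x y| ≤ (α + 2) * |x| + (α + 2) * α ∧ |hillVy α x y| ≤ (α + 2) * α := by
  have h1 := hillR_ge_one hα h hW
  have hp := hillR_pos h
  have h2 : hillR x y ≤ hillR x y ^ (α + 2) :=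
    Real.self_le_rpow_of_one_le h1 (by linarith)
  have hx : |x| ≤ hillR x y := Real.abs_le_sqrt (by nlinarith [sq_nonneg y])
  have hy : |y| ≤ hillR x y := Real.abs_le_sqrt (by nlinarith [sq_nonneg x])
  have hq : 0 < hillR x y ^ (α + 2) := Real.rpow_pos_of_pos hp _
  have hc : 0 ≤ (α + 2) * α := by nlinarith
  have key : ∀ z : ℝ, |z| ≤ hillR x y → |(α + 2) * α * z / hillR x y ^ (α + 2)| ≤ (α + 2) * α := by
    intro z hz
    rw [abs_div, abs_mul, abs_of_nonneg hc, abs_of_pos hq, div_le_iff₀ hq]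
    exact mul_le_mul_of_nonneg_left (hz.trans h2) hc
  refine ⟨?_, key y hy⟩
  unfold hillVx
  refine (abs_add_le _ _).trans (add_le_add ?_ (key x hx))
  rw [abs_mul, abs_neg, abs_of_nonneg (by linarith : 0 ≤ α + 2)]

lemma tendsto_of_bdd_deriv {f f' : ℝ → ℝ} {T C : ℝ} (hT : 0 < T)
    (hf : ∀ t ∈ Ico 0 T, HasDerivAt f (f' t) t) (hC : ∀ t ∈ Ico 0 T, |f' t| ≤ C) :
    ∃ l, Tendsto f (𝓝[<] T) (𝓝 l) := by
  have hC0 : 0 ≤ C := (abs_nonneg _).trans (hC 0 ⟨le_rfl, hT⟩)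
  have hL : LipschitzOnWith ⟨C, hC0⟩ f (Ico 0 T) :=
    (convex_Ico 0 T).lipschitzOnWith_of_nnnorm_hasDerivWithin_le
      (fun t ht => (hf t ht).hasDerivWithinAt) (fun t ht => hC t ht)
  obtain ⟨g, hg, hfg⟩ := hL.extend_real
  refine ⟨g T, ?_⟩
  have h1 : Tendsto g (𝓝[<] T) (𝓝 (g T)) := (hg.continuous.tendsto T).mono_left nhdsWithin_le_nhds
  refine h1.congr' ?_
  filter_upwards [Ico_mem_nhdsLT hT] with t ht
  exact (hfg ht).symm

/-- Gluing two `C¹` pieces at `T`. -/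
lemma glue_hasDerivAt {f f' g g' : ℝ → ℝ} {T ε : ℝ} (hT : 0 < T) (hε : 0 < ε)
    (hf : ∀ t ∈ Ico 0 T, HasDerivAt f (f' t) t)
    (hg : ∀ t ∈ Ioo (T - ε) (T + ε), HasDerivAt g (g' t) t)
    (h0 : Tendsto f (𝓝[<] T) (𝓝 (g T))) (h1 : Tendsto f' (𝓝[<] T) (𝓝 (g' T))) :
    ∀ t ∈ Ico 0 (T + ε), HasDerivAt (fun s => if s < T then f s else g s)
      (if t < T then f' t else g' t) t := by
  intro t ht
  rcases lt_trichotomy t T with h | h | h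
  · rw [if_pos h]
    refine (hf t ⟨ht.1, h⟩).congr_of_eventuallyEq ?_
    filter_upwards [Iio_mem_nhds h] with s hs
    exact if_pos hs
  · subst h
    rw [if_neg (lt_irrefl _)]
    have hr : HasDerivWithinAt (fun s => if s < t then f s else g s) (g' t) (Ici t) t := by
      refine (hg t ⟨by linarith, by linarith⟩).hasDerivWithinAt.congr ?_ ?_
      · intro s hs
        exact if_neg (not_lt.2 hs)
      · exact if_neg (lt_irrefl _)
    have hev : ∀ s ∈ Ioo 0 t, HasDerivAt (fun s => if s < t then f s else g s) (f' s) s := by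
      intro s hs
      refine (hf s ⟨hs.1.le, hs.2⟩).congr_of_eventuallyEq ?_
      filter_upwards [Iio_mem_nhds hs.2] with r hr
      exact if_pos hr
    have hl : HasDerivWithinAt (fun s => if s < t then f s else g s) (g' t) (Iic t) t := by
      refine hasDerivWithinAt_Iic_of_tendsto_deriv (s := Ioo 0 t) ?_ ?_ (Ioo_mem_nhdsLT hT) ?_
      · intro s hs
        exact (hev s hs).differentiableAt.differentiableWithinAt
      · unfold ContinuousWithinAt
        simp only [lt_irrefl, if_false]
        refine (h0.mono_left (nhdsWithin_mono _ Ioo_subset_Iio_self)).congr' ?_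
        filter_upwards [self_mem_nhdsWithin] with s hs
        exact (if_pos hs.2).symm
      · refine h1.congr' ?_
        filter_upwards [Ioo_mem_nhdsLT hT] with s hs
        exact (hev s hs).deriv.symm
    have := hl.union hr
    rw [Iic_union_Ici] at this
    exact this.hasDerivAt univ_mem
  · rw [if_neg h.not_gt]
    refine (hg t ⟨by linarith, ht.2⟩).congr_of_eventuallyEq ?_
    filter_upwards [Ioi_mem_nhds h] with s hs
    exact if_neg (not_lt.2 (le_of_lt hs))

lemma hillDomain_ofReal {T : ℝ} (t : ℝ) : t ∈ hillDomain (ENNReal.ofReal T) ↔ t ∈ Ico 0 T := by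
  unfold hillDomain
  constructor
  · rintro ⟨h, h'⟩
    exact ⟨h, (ENNReal.ofReal_lt_ofReal_iff_of_nonneg h).1 h'⟩
  · rintro ⟨h, h'⟩
    exact ⟨h, (ENNReal.ofReal_lt_ofReal_iff_of_nonneg h).2 h'⟩

lemma hill_energy {α T : ℝ} {x y u v : ℝ → ℝ}
    (hne : ∀ t ∈ Ico 0 T, (x t, y t) ≠ (0, 0))
    (hx : ∀ t ∈ Ico 0 T, HasDerivAt x (u t) t) (hy : ∀ t ∈ Ico 0 T, HasDerivAt y (v t) t)
    (hu : ∀ t ∈ Ico 0 T, HasDerivAt u (2 * v t - hillVx α (x t) (y t)) t)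
    (hv : ∀ t ∈ Ico 0 T, HasDerivAt v (-(2 * u t) - hillVy α (x t) (y t)) t) :
    ∀ t ∈ Ico 0 T, hillE α (x t) (y t) (u t) (v t) = hillE α (x 0) (y 0) (u 0) (v 0) := by
  intro t ht
  have hd : ∀ s ∈ Ico 0 T, HasDerivAt (fun s => hillE α (x s) (y s) (u s) (v s)) 0 s :=
    fun s hs => hillE_hasDerivAt (hx s hs) (hy s hs) (hne s hs) (hu s hs) (hv s hs)
  exact constant_of_has_deriv_right_zero (f := fun s => hillE α (x s) (y s) (u s) (v s))
    (a := 0) (b := t)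
    (fun s hs => (hd s ⟨hs.1, hs.2.trans_lt ht.2⟩).continuousAt.continuousWithinAt)
    (fun s hs => (hd s ⟨hs.1, hs.2.trans ht.2⟩).hasDerivWithinAt) t ⟨ht.1, le_rfl⟩

lemma hill_W_pos {α T : ℝ} (hα : 2 ≤ α) {x y u v : ℝ → ℝ}
    (hne : ∀ t ∈ Ico 0 T, (x t, y t) ≠ (0, 0))
    (hx : ∀ t ∈ Ico 0 T, HasDerivAt x (u t) t) (hy : ∀ t ∈ Ico 0 T, HasDerivAt y (v t) t)
    (hu : ∀ t ∈ Ico 0 T, HasDerivAt u (2 * v t - hillVx α (x t) (y t)) t)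
    (hv : ∀ t ∈ Ico 0 T, HasDerivAt v (-(2 * u t) - hillVy α (x t) (y t)) t)
    (hE : ∀ t ∈ Ico 0 T, hillE α (x t) (y t) (u t) (v t) = hillEstar α)
    (hW : 0 < hillW α (x 0) (y 0)) :
    ∀ t ∈ Ico 0 T, 0 < hillW α (x t) (y t) := by
  intro s hs
  by_contra hcon
  have hWc : ∀ t ∈ Ico 0 T, ContinuousAt (fun s => hillW α (x s) (y s)) t := fun t ht =>
    hillW_continuousAt (hx t ht).continuousAt (hy t ht).continuousAt (hne t ht)
  have hsub : ∀ t ∈ Icc 0 s, t ∈ Ico 0 T := fun t ht => ⟨ht.1, ht.2.trans_lt hs.2⟩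
  have hcl : IsClosed (Icc 0 s ∩ (fun s => hillW α (x s) (y s)) ⁻¹' Iic 0) :=
    ContinuousOn.preimage_isClosed_of_isClosed
      (fun t ht => (hWc t (hsub t ht)).continuousWithinAt) isClosed_Icc isClosed_Iic
  have hcp : IsCompact (Icc 0 s ∩ (fun s => hillW α (x s) (y s)) ⁻¹' Iic 0) :=
    isCompact_Icc.of_isClosed_subset hcl inter_subset_left
  obtain ⟨t₁, ⟨ht₁, hWt₁⟩, hleast⟩ := hcp.exists_isLeast ⟨s, ⟨hs.1, le_rfl⟩, not_lt.1 hcon⟩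
  have hWt₁' : hillW α (x t₁) (y t₁) ≤ 0 := hWt₁
  have hT₁ := hsub t₁ ht₁
  have hpos : 0 < t₁ := by
    rcases ht₁.1.eq_or_lt with h | h
    · rw [← h] at hWt₁'; linarith
    · exact h
  have hbefore : ∀ t ∈ Ico 0 t₁, 0 < hillW α (x t) (y t) := by
    intro t ht
    by_contra hc
    have := hleast ⟨⟨ht.1, ht.2.le.trans ht₁.2⟩, not_lt.1 hc⟩
    linarith [ht.2]
  have hW0 : hillW α (x t₁) (y t₁) = 0 := by
    refine le_antisymm hWt₁' ?_
    have : Tendsto (fun s => hillW α (x s) (y s)) (𝓝[<] t₁) (𝓝 (hillW α (x t₁) (y t₁))) :=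
      (hWc t₁ hT₁).tendsto.mono_left nhdsWithin_le_nhds
    refine ge_of_tendsto this ?_
    filter_upwards [Ico_mem_nhdsLT hpos] with t ht
    exact (hbefore t ht).le
  obtain ⟨hu0, hv0, hy0, hr⟩ := hill_equilibrium hα (hne t₁ hT₁) hW0 (hE t₁ hT₁)
  obtain ⟨K, S, hS, hLip⟩ := (hillF_contDiffAt α (x t₁, y t₁, u t₁, v t₁)
    (hne t₁ hT₁)).exists_lipschitzOnWith
  have hF0 : hillF α (x t₁, y t₁, u t₁, v t₁) = 0 := by
    have hα0 : α ≠ 0 := by linarith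
    unfold hillF hillVx hillVy
    simp only [hr, hu0, hv0]
    rw [hy0]
    simp only [Prod.mk_eq_zero]
    refine ⟨trivial, trivial, ?_, ?_⟩
    · field_simp; ring
    · simp
  have hder : ∀ t ∈ Ico 0 T, HasDerivAt (fun t => (x t, y t, u t, v t))
      (hillF α (x t, y t, u t, v t)) t := fun t ht =>
    (hx t ht).prodMk ((hy t ht).prodMk ((hu t ht).prodMk (hv t ht)))
  have huniq : (fun t => (x t, y t, u t, v t)) =ᶠ[𝓝 t₁]
      (fun _ => (x t₁, y t₁, u t₁, v t₁)) := by
    refine ODE_solution_unique_of_eventually (v := fun _ => hillF α) (s := fun _ => S) (K := K)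
      (Eventually.of_forall fun _ => hLip) ?_ ?_ rfl
    · have hc : ContinuousAt (fun t => (x t, y t, u t, v t)) t₁ := (hder t₁ hT₁).continuousAt
      filter_upwards [Ioo_mem_nhds hpos hT₁.2, hc hS] with t ht ht'
      exact ⟨hder t ⟨ht.1.le, ht.2⟩, ht'⟩
    · refine Eventually.of_forall fun t => ⟨?_, mem_of_mem_nhds hS⟩
      rw [hF0]
      exact hasDerivAt_const _ _
  have h1 : ∀ᶠ t in 𝓝[<] t₁, False := by
    filter_upwards [Ico_mem_nhdsLT hpos, huniq.filter_mono nhdsWithin_le_nhds] with t ht hteq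
    have := hbefore t ht
    simp only [Prod.mk.injEq] at hteq
    rw [hteq.1, hteq.2.1, hW0] at this
    exact lt_irrefl _ this
  exact h1.exists.elim fun _ h => h

lemma hill_x_bdd {α T : ℝ} (hα : 2 ≤ α) {x u : ℝ → ℝ}
    (hx : ∀ t ∈ Ico 0 T, HasDerivAt x (u t) t)
    (hb : ∀ t ∈ Ico 0 T, u t ^ 2 ≤ (α + 2) * (x t ^ 2 + 2)) :
    ∃ M, ∀ t ∈ Ico 0 T, |x t| ≤ M := by
  have hb' : ∀ t ∈ Ico 0 T, ‖u t‖ ≤ (α + 2) * ‖x t‖ + (α + 2) * 2 := by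
    intro t ht
    rw [Real.norm_eq_abs, Real.norm_eq_abs]
    have h0 := abs_nonneg (x t)
    have hnn : 0 ≤ (α + 2) * |x t| + (α + 2) * 2 := by
      have : 0 ≤ α + 2 := by linarith
      positivity
    refine abs_le_of_sq_le_sq ?_ hnn
    refine (hb t ht).trans ?_
    rw [← sq_abs (x t)]
    nlinarith [mul_nonneg (show 0 ≤ α + 2 by linarith) h0, mul_nonneg (show 0 ≤ α + 2 by linarith) (sq_nonneg |x t|),
      mul_nonneg (show 0 ≤ (α + 2) * (α + 1) by nlinarith) (sq_nonneg (|x t| + 2))]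
  obtain ⟨M, hM⟩ := (isCompact_Icc (a := (0:ℝ)) (b := T)).bddAbove_image
    (f := gronwallBound ‖x 0‖ (α + 2) ((α + 2) * 2))
    (fun t _ => (hasDerivAt_gronwallBound _ _ _ t).continuousAt.continuousWithinAt)
  refine ⟨M, fun t ht => ?_⟩
  have := norm_le_gronwallBound_of_norm_deriv_right_le (f := x) (f' := u) (a := 0) (b := t)
    (δ := ‖x 0‖) (K := α + 2) (ε := (α + 2) * 2)
    (fun s hs => (hx s ⟨hs.1, hs.2.trans_lt ht.2⟩).continuousAt.continuousWithinAt)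
    (fun s hs => (hx s ⟨hs.1, hs.2.trans ht.2⟩).hasDerivWithinAt) le_rfl
    (fun s hs => hb' s ⟨hs.1, hs.2.trans ht.2⟩) t ⟨ht.1, le_rfl⟩
  rw [sub_zero] at this
  exact this.trans (hM ⟨t, ⟨ht.1, ht.2.le⟩, rfl⟩)

/-- for α ≥ 2, solutions with E = E* and W > 0 initially exist globally in
forward time. -/
theorem hill_at_ground_state_global_existence
    (α : ℝ) (hα : 2 ≤ α) (Tmax : ℝ≥0∞) (hT : 0 < Tmax) (x y : ℝ → ℝ)
    (hsol : HillMaxSol α x y Tmax)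
    (hE : hillE α (x 0) (y 0) (deriv x 0) (deriv y 0) = hillEstar α)
    (hW : 0 < hillW α (x 0) (y 0)) :
    Tmax = ⊤ := by
  by_contra hTop
  obtain ⟨T, rfl⟩ : ∃ T, Tmax = ENNReal.ofReal T := ⟨Tmax.toReal, (ENNReal.ofReal_toReal hTop).symm⟩
  have hT0 : 0 < T := ENNReal.ofReal_pos.1 hT
  obtain ⟨hs, hmax⟩ := hsol
  have hs' := fun t (ht : t ∈ Ico 0 T) =>
    hs t ((hillDomain_ofReal t).2 ht)
  have hne : ∀ t ∈ Ico 0 T, (x t, y t) ≠ (0, 0) := fun t ht => (hs' t ht).1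
  have hx : ∀ t ∈ Ico 0 T, HasDerivAt x (deriv x t) t := fun t ht => (hs' t ht).2.1
  have hy : ∀ t ∈ Ico 0 T, HasDerivAt y (deriv y t) t := fun t ht => (hs' t ht).2.2.1
  have hu : ∀ t ∈ Ico 0 T, HasDerivAt (deriv x) (2 * deriv y t - hillVx α (x t) (y t)) t :=
    fun t ht => (hs' t ht).2.2.2.1
  have hv : ∀ t ∈ Ico 0 T, HasDerivAt (deriv y) (-(2 * deriv x t) - hillVy α (x t) (y t)) t :=
    fun t ht => (hs' t ht).2.2.2.2
  have hEt : ∀ t ∈ Ico 0 T, hillE α (x t) (y t) (deriv x t) (deriv y t) = hillEstar α :=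
    fun t ht => (hill_energy hne hx hy hu hv t ht).trans hE
  have hWt := hill_W_pos hα hne hx hy hu hv hEt hW
  have hsp := fun t ht => hill_speed hα (hne t ht) (hWt t ht).le (hEt t ht)
  have hfo := fun t ht => hill_force hα (hne t ht) (hWt t ht).le
  obtain ⟨M, hM⟩ := hill_x_bdd hα hx
    (fun t ht => le_trans (by nlinarith [sq_nonneg (deriv y t)]) (hsp t ht))
  have hsp2 : ∀ t ∈ Ico 0 T, deriv x t ^ 2 + deriv y t ^ 2 ≤ (α + 2) * (M ^ 2 + 2) := by
    intro t ht
    refine (hsp t ht).trans (mul_le_mul_of_nonneg_left ?_ (by linarith))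
    have := sq_le_sq' (by linarith [hM t ht, abs_nonneg (x t)]) (hM t ht)
    rw [sq_abs] at this
    linarith
  set B := Real.sqrt ((α + 2) * (M ^ 2 + 2)) with hB
  have hub : ∀ t ∈ Ico 0 T, |deriv x t| ≤ B := fun t ht =>
    Real.abs_le_sqrt (le_trans (by nlinarith [sq_nonneg (deriv y t)]) (hsp2 t ht))
  have hvb : ∀ t ∈ Ico 0 T, |deriv y t| ≤ B := fun t ht =>
    Real.abs_le_sqrt (le_trans (by nlinarith [sq_nonneg (deriv x t)]) (hsp2 t ht))
  obtain ⟨a, ha⟩ := tendsto_of_bdd_deriv hT0 hx hub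
  obtain ⟨b, hb⟩ := tendsto_of_bdd_deriv hT0 hy hvb
  obtain ⟨c, hc⟩ := tendsto_of_bdd_deriv (C := 2 * B + ((α + 2) * M + (α + 2) * α)) hT0 hu (by
    intro t ht
    have h1 := (hfo t ht).1
    have h2 := mul_le_mul_of_nonneg_left (hM t ht) (show 0 ≤ α + 2 by linarith)
    have h3 := abs_le.1 (hvb t ht)
    have h4 := abs_le.1 h1
    rw [abs_le]
    constructor <;> linarith)
  obtain ⟨d, hd⟩ := tendsto_of_bdd_deriv (C := 2 * B + ((α + 2) * α)) hT0 hv (by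
    intro t ht
    have h3 := abs_le.1 (hub t ht)
    have h4 := abs_le.1 (hfo t ht).2
    rw [abs_le]
    constructor <;> linarith)
  have hab : 1 ≤ a ^ 2 + b ^ 2 := by
    refine ge_of_tendsto ((ha.pow 2).add (hb.pow 2)) ?_
    filter_upwards [Ico_mem_nhdsLT hT0] with t ht
    have := hillR_ge_one hα (hne t ht) (hWt t ht).le
    rw [← hillR_sq]
    nlinarith
  have hab' : (a, b) ≠ (0, 0) := by
    intro h
    rw [Prod.mk.injEq] at h
    rw [h.1, h.2] at hab
    norm_num at hab
  have hCD := hillF_contDiffAt α (a, b, c, d) hab'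
  obtain ⟨z, hz0, ε, hε, hz⟩ :=
    hCD.exists_forall_mem_closedBall_exists_eq_forall_mem_Ioo_hasDerivAt₀ T
  -- shrink ε so that z avoids the origin
  have hzc : ContinuousAt z T := (hz T ⟨by linarith, by linarith⟩).continuousAt
  have hev : ∀ᶠ t in 𝓝 T, ((z t).1, (z t).2.1) ≠ ((0 : ℝ), (0 : ℝ)) := by
    have hcc : ContinuousAt (fun t => ((z t).1, (z t).2.1)) T := by fun_prop
    refine hcc.eventually_ne ?_
    rw [hz0]
    exact hab'
  obtain ⟨δ, hδ, hball⟩ := Metric.eventually_nhds_iff_ball.1 hev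
  rw [Real.ball_eq_Ioo] at hball
  obtain ⟨η, hη, hηε, hηδ⟩ : ∃ η > 0, η ≤ ε ∧ η ≤ δ :=
    ⟨min ε δ, lt_min hε hδ, min_le_left _ _, min_le_right _ _⟩
  have hzne : ∀ t ∈ Ioo (T - η) (T + η), ((z t).1, (z t).2.1) ≠ ((0 : ℝ), (0 : ℝ)) :=
    fun t ht => hball t ⟨by linarith [ht.1], by linarith [ht.2]⟩
  have hz' : ∀ t ∈ Ioo (T - η) (T + η), HasDerivAt z (hillF α (z t)) t :=
    fun t ht => hz t ⟨by linarith [ht.1], by linarith [ht.2]⟩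
  have hz1 : ∀ t ∈ Ioo (T - η) (T + η), HasDerivAt (fun t => (z t).1) ((z t).2.2.1) t :=
    fun t ht => (hz' t ht).fst
  have hz2 : ∀ t ∈ Ioo (T - η) (T + η), HasDerivAt (fun t => (z t).2.1) ((z t).2.2.2) t :=
    fun t ht => (hz' t ht).snd.fst
  have hz3 : ∀ t ∈ Ioo (T - η) (T + η), HasDerivAt (fun t => (z t).2.2.1)
      (2 * (z t).2.2.2 - hillVx α (z t).1 (z t).2.1) t :=
    fun t ht => (hz' t ht).snd.snd.fst
  have hz4 : ∀ t ∈ Ioo (T - η) (T + η), HasDerivAt (fun t => (z t).2.2.2)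
      (-(2 * (z t).2.2.1) - hillVy α (z t).1 (z t).2.1) t :=
    fun t ht => (hz' t ht).snd.snd.snd
  have hFlim : Tendsto (fun t => hillF α (x t, y t, deriv x t, deriv y t)) (𝓝[<] T)
      (𝓝 (hillF α (a, b, c, d))) :=
    hCD.continuousAt.tendsto.comp
      (ha.prodMk_nhds (hb.prodMk_nhds (hc.prodMk_nhds hd)))
  have hl3 : Tendsto (fun t => 2 * deriv y t - hillVx α (x t) (y t)) (𝓝[<] T)
      (𝓝 (2 * d - hillVx α a b)) := hFlim.snd_nhds.snd_nhds.fst_nhds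
  have hl4 : Tendsto (fun t => -(2 * deriv x t) - hillVy α (x t) (y t)) (𝓝[<] T)
      (𝓝 (-(2 * c) - hillVy α a b)) := hFlim.snd_nhds.snd_nhds.snd_nhds
  have g1 := glue_hasDerivAt hT0 hη hx hz1 (by simpa [hz0] using ha) (by simpa [hz0] using hc)
  have g2 := glue_hasDerivAt hT0 hη hy hz2 (by simpa [hz0] using hb) (by simpa [hz0] using hd)
  have g3 := glue_hasDerivAt hT0 hη hu hz3 (by simpa [hz0] using hc) (by simpa [hz0] using hl3)
  have g4 := glue_hasDerivAt hT0 hη hv hz4 (by simpa [hz0] using hd) (by simpa [hz0] using hl4)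
  set X : ℝ → ℝ := fun s => if s < T then x s else (z s).1 with hX
  set Y : ℝ → ℝ := fun s => if s < T then y s else (z s).2.1 with hY
  have hevd : ∀ (f g f' : ℝ → ℝ), (∀ t ∈ Ico 0 (T + η),
      HasDerivAt (fun s => if s < T then f s else g s) (if t < T then deriv f t else f' t) t) →
      ∀ t ∈ Ico 0 (T + η), deriv (fun s => if s < T then f s else g s) =ᶠ[𝓝 t]
        (fun s => if s < T then deriv f s else f' s) := by
    intro f g f' hfg t ht
    rcases lt_or_ge t T with h | h
    · filter_upwards [Iio_mem_nhds h] with s hs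
      rw [if_pos (show s < T from hs)]
      refine Filter.EventuallyEq.deriv_eq ?_
      filter_upwards [Iio_mem_nhds hs] with r hr
      exact if_pos hr
    · filter_upwards [Ioo_mem_nhds (hT0.trans_le h) ht.2] with s hs
      exact (hfg s ⟨hs.1.le, hs.2⟩).deriv
  have eX := hevd x (fun s => (z s).1) (fun s => (z s).2.2.1) g1
  have eY := hevd y (fun s => (z s).2.1) (fun s => (z s).2.2.2) g2
  refine hmax (ENNReal.ofReal (T + η)) ?_ ⟨X, Y, ?_, ?_⟩
  · exact (ENNReal.ofReal_lt_ofReal_iff (by linarith)).2 (by linarith)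
  · intro t ht
    rw [hillDomain_ofReal] at ht
    have dX := (eX t ht).eq_of_nhds
    have dY := (eY t ht).eq_of_nhds
    refine ⟨?_, ?_, ?_, ?_, ?_⟩
    · by_cases h : t < T
      · simp only [hX, hY, if_pos h]
        exact hne t ⟨ht.1, h⟩
      · simp only [hX, hY, if_neg h]
        exact hzne t ⟨by linarith, ht.2⟩
    · exact (g1 t ht).differentiableAt.hasDerivAt
    · exact (g2 t ht).differentiableAt.hasDerivAt
    · refine ((g3 t ht).congr_of_eventuallyEq (eX t ht)).congr_deriv ?_
      rw [dY]
      by_cases h : t < T <;> simp [hX, hY, h]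
    · refine ((g4 t ht).congr_of_eventuallyEq (eY t ht)).congr_deriv ?_
      rw [dX]
      by_cases h : t < T <;> simp [hX, hY, h]
  · intro t ht
    rw [hillDomain_ofReal] at ht
    exact ⟨if_pos ht.2, if_pos ht.2⟩
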